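/- Let Σ₁, Σ₂ be nonzero vector subspaces of Sym(2,ℝ) and let H₁, H₂ be nontrivial connected subgroups of GL(2,ℝ) (connected as topological subspaces of GL(2,ℝ)) such that h†[Σᵢ] = Σᵢ for all h ∈ Hᵢ (i = 1,2), and set Gᵢ = Σᵢ⋊Hᵢ = {g(σ,h) : σ ∈ Σᵢ, h ∈ Hᵢ} ⊆ Sp(2,ℝ). Assume there is no h₀ ∈ GL(2,ℝ) with g(0,h₀)·G₁·g(0,h₀)⁻¹ = G₂. If g ∈ Sp(2,ℝ) satisfies g·G₁·g⁻¹ = G₂, then there exist σ' ∈ Sym(2,ℝ), h, h' ∈ GL(2,ℝ) and a₀ ∈ ℝ such that g = g(σ',h')⁻¹ w₀ g(a₀σ₄, h), where necessarily tr(τ σ₄) = 0 for every τ ∈ h†[Σ₁], and h H₁ h⁻¹ is contained in the group T of invertible lower triangular matrices; furthermore a₀ ≠ 0 is possible only if h H₁ h⁻¹ ⊆ {[[α,0],[β,1]] : α > 0, β ∈ ℝ}. -/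

import Mathlib

open Matrix

noncomputable section

abbrev M2 := Matrix (Fin 2) (Fin 2) ℝ
abbrev M4 := Matrix (Fin 2 ⊕ Fin 2) (Fin 2 ⊕ Fin 2) ℝ

/-- The standard symplectic form `J = [[0, I₂], [-I₂, 0]]`. -/
def Jmat : M4 := fromBlocks 0 1 (-1) 0

/-- The symplectic group `Sp(2, ℝ)` as a set of `4 × 4` matrices. -/
def SpSet : Set M4 := {g | gᵀ * Jmat * g = Jmat}

/-- The block matrix `g(σ, h) = [[h, 0], [σh, ᵀh⁻¹]]`. -/
def gmat (σ h : M2) : M4 := fromBlocks h 0 (σ * h) h⁻¹ᵀ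

/-- The action `h†[σ] = ᵀh⁻¹ σ h⁻¹`. -/
def dag (h σ : M2) : M2 := h⁻¹ᵀ * σ * h⁻¹

/-- The semidirect product set `Σ ⋊ H = {g(σ, h) : σ ∈ Σ, h ∈ H}`. -/
def sdp (S H : Set M2) : Set M4 := {g | ∃ σ ∈ S, ∃ h ∈ H, g = gmat σ h}

/-- Conjugation of a set of `4 × 4` matrices: `g·S·g⁻¹`. -/
def conj4 (g : M4) (S : Set M4) : Set M4 := (fun x => g * x * g⁻¹) '' S

/-- `σ₄ = [[0,0],[0,1]]`. -/
def sigma4 : M2 := !![0, 0; 0, 1]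

/-- The group `T` of invertible lower triangular real `2 × 2` matrices. -/
def Tgrp : Set M2 := {m | ∃ a b c : ℝ, a * c ≠ 0 ∧ m = !![c, 0; b, a]}

/-- The Weyl element `w₀` with rows `(1,0,0,0), (0,0,0,-1), (0,0,1,0), (0,1,0,0)`. -/
def w0 : M4 := fromBlocks !![1, 0; 0, 0] (-(!![0, 0; 0, 1])) !![0, 0; 0, 1] !![1, 0; 0, 0]

lemma sp_inv {g : M4} (hg : g ∈ SpSet) : (-(Jmat * gᵀ * Jmat)) * g = 1 := by
  have hJ : Jmat * Jmat = -1 := by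
    rw [Jmat, fromBlocks_multiply, ← fromBlocks_one, fromBlocks_neg]
    simp
  have h : gᵀ * Jmat * g = Jmat := hg
  calc (-(Jmat * gᵀ * Jmat)) * g = -(Jmat * (gᵀ * Jmat * g)) := by
        simp only [Matrix.neg_mul, Matrix.mul_assoc]
    _ = 1 := by rw [h, hJ, neg_neg]

lemma sp_unit {g : M4} (hg : g ∈ SpSet) : IsUnit g.det :=
  Matrix.isUnit_det_of_left_inverse (sp_inv hg)

lemma sp_inv_eq {g : M4} (hg : g ∈ SpSet) : g⁻¹ = -(Jmat * gᵀ * Jmat) :=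
  Matrix.inv_eq_left_inv (sp_inv hg)

lemma sp_inv_blocks {A B C D : M2} (hg : fromBlocks A B C D ∈ SpSet) :
    (fromBlocks A B C D)⁻¹ = fromBlocks Dᵀ (-Bᵀ) (-Cᵀ) Aᵀ := by
  rw [sp_inv_eq hg, Jmat, fromBlocks_transpose, fromBlocks_multiply, fromBlocks_multiply,
    fromBlocks_neg]
  simp

lemma sp_mul {g k : M4} (hg : g ∈ SpSet) (hk : k ∈ SpSet) : g * k ∈ SpSet := by
  have h1 : gᵀ * Jmat * g = Jmat := hg
  have h2 : kᵀ * Jmat * k = Jmat := hk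
  show (g * k)ᵀ * Jmat * (g * k) = Jmat
  calc (g * k)ᵀ * Jmat * (g * k) = kᵀ * (gᵀ * Jmat * g) * k := by
        simp only [transpose_mul, Matrix.mul_assoc]
    _ = Jmat := by rw [h1, h2]

lemma sp_inv_mem {g : M4} (hg : g ∈ SpSet) : g⁻¹ ∈ SpSet := by
  have h1 : gᵀ * Jmat * g = Jmat := hg
  have hu := sp_unit hg
  have e : g * g⁻¹ = 1 := Matrix.mul_nonsing_inv _ hu
  have e' : (g⁻¹)ᵀ * gᵀ = 1 := by rw [← transpose_mul, e, transpose_one]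
  show (g⁻¹)ᵀ * Jmat * g⁻¹ = Jmat
  calc (g⁻¹)ᵀ * Jmat * g⁻¹ = (g⁻¹)ᵀ * (gᵀ * Jmat * g) * g⁻¹ := by rw [h1]
    _ = ((g⁻¹)ᵀ * gᵀ) * Jmat * (g * g⁻¹) := by simp only [Matrix.mul_assoc]
    _ = Jmat := by rw [e, e']; simp

lemma w0_sp : w0 ∈ SpSet := by
  show w0ᵀ * Jmat * w0 = Jmat
  rw [w0, Jmat, fromBlocks_transpose, fromBlocks_multiply, fromBlocks_multiply]
  congr 1 <;> ext i j <;> fin_cases i <;> fin_cases j <;> simp [Matrix.mul_apply, Fin.sum_univ_two]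

lemma tinv {h : M2} (hh : IsUnit h) : hᵀ * (h⁻¹)ᵀ = 1 := by
  rw [← transpose_mul, Matrix.nonsing_inv_mul _ ((Matrix.isUnit_iff_isUnit_det _).1 hh),
    transpose_one]

lemma tinv' {h : M2} (hh : IsUnit h) : (h⁻¹)ᵀ * hᵀ = 1 := by
  rw [← transpose_mul, Matrix.mul_nonsing_inv _ ((Matrix.isUnit_iff_isUnit_det _).1 hh),
    transpose_one]

lemma minv {h : M2} (hh : IsUnit h) : h * h⁻¹ = 1 :=
  Matrix.mul_nonsing_inv _ ((Matrix.isUnit_iff_isUnit_det _).1 hh)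

lemma minv' {h : M2} (hh : IsUnit h) : h⁻¹ * h = 1 :=
  Matrix.nonsing_inv_mul _ ((Matrix.isUnit_iff_isUnit_det _).1 hh)

lemma gmat_sp {s h : M2} (hs : sᵀ = s) (hh : IsUnit h) : gmat s h ∈ SpSet := by
  show (gmat s h)ᵀ * Jmat * gmat s h = Jmat
  rw [gmat, Jmat, fromBlocks_transpose, fromBlocks_multiply, fromBlocks_multiply]
  congr 1
  · simp [hs, Matrix.mul_assoc]
  · simp [tinv hh]
  · simp [minv' hh]
  · simp

lemma sp_lower {A C D : M2} (hg : fromBlocks A 0 C D ∈ SpSet) :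
    IsUnit A ∧ ∃ s : M2, sᵀ = s ∧ fromBlocks A 0 C D = gmat s A := by
  have e := Matrix.mul_nonsing_inv _ (sp_unit hg)
  rw [sp_inv_blocks hg, fromBlocks_multiply, ← fromBlocks_one, fromBlocks_inj] at e
  obtain ⟨e1, e2, e3, e4⟩ := e
  simp only [Matrix.zero_mul, neg_zero, add_zero, Matrix.mul_neg] at e1 e3
  have hA : IsUnit A := (Matrix.isUnit_iff_isUnit_det _).2 (Matrix.isUnit_det_of_right_inverse e1)
  have hD : A⁻¹ᵀ = D := by
    rw [Matrix.inv_eq_right_inv e1, transpose_transpose]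
  have e3' : C * Dᵀ = D * Cᵀ := by
    have := e3; rwa [← sub_eq_add_neg, sub_eq_zero] at this
  refine ⟨hA, C * A⁻¹, ?_, ?_⟩
  · rw [transpose_mul, hD, ← e3', ← hD, transpose_transpose]
  · rw [gmat, hD, Matrix.mul_assoc, minv' hA, Matrix.mul_one]

lemma gmat_mul {s t a b : M2} (ha : IsUnit a) :
    gmat s a * gmat t b = gmat (s + dag a t) (a * b) := by
  rw [gmat, gmat, gmat, fromBlocks_multiply, Matrix.mul_inv_rev, dag]
  congr 1
  · simp
  · simp
  · rw [Matrix.add_mul]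
    congr 1
    · simp [Matrix.mul_assoc]
    · calc a⁻¹ᵀ * (t * b) = a⁻¹ᵀ * t * (1 * b) := by simp [Matrix.mul_assoc]
        _ = _ := by rw [← minv' ha]; simp only [Matrix.mul_assoc]
  · simp

lemma gmat_inj {s t a b : M2} (ha : IsUnit a) (h : gmat s a = gmat t b) : s = t ∧ a = b := by
  rw [gmat, gmat, fromBlocks_inj] at h
  obtain ⟨h1, -, h3, -⟩ := h
  subst h1
  refine ⟨?_, rfl⟩
  have := congrArg (· * a⁻¹) h3
  simpa [Matrix.mul_assoc, minv ha] using this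

lemma dag_mul (a b t : M2) : dag (a * b) t = dag a (dag b t) := by
  simp [dag, Matrix.mul_inv_rev, Matrix.mul_assoc]

lemma gmat_conj {s a t k : M2} (hs : sᵀ = s) (ha : IsUnit a) (hk : IsUnit k) :
    gmat s a * gmat t k * (gmat s a)⁻¹ =
      gmat (s + dag a t - dag (a * k * a⁻¹) s) (a * k * a⁻¹) := by
  have hai : IsUnit a⁻¹ := (Matrix.isUnit_nonsing_inv_iff).2 ha
  have hu := sp_unit (gmat_sp hs ha)
  have : gmat s a * gmat t k = gmat (s + dag a t - dag (a * k * a⁻¹) s) (a * k * a⁻¹) * gmat s a := by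
    rw [gmat_mul ha, gmat_mul ((ha.mul hk).mul hai)]
    congr 1
    · abel
    · rw [Matrix.mul_assoc, minv' ha, Matrix.mul_one]
  rw [this, Matrix.mul_assoc, Matrix.mul_nonsing_inv _ hu, Matrix.mul_one]

lemma dag_one (t : M2) : dag 1 t = t := by simp [dag]

lemma dag_zero (h : M2) : dag h 0 = 0 := by simp [dag]

lemma case_zero (S1 S2 : Submodule ℝ M2) (H1 H2 : Set M2)
    (hH1unit : ∀ h ∈ H1, IsUnit h) (hH1one : (1 : M2) ∈ H1) (hH2one : (1 : M2) ∈ H2)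
    (s a : M2) (hs : sᵀ = s) (ha : IsUnit a)
    (hconj : conj4 (gmat s a) (sdp (S1 : Set M2) H1) = sdp (S2 : Set M2) H2) :
    conj4 (gmat 0 a) (sdp (S1 : Set M2) H1) = sdp (S2 : Set M2) H2 := by
  have hai : IsUnit a⁻¹ := (Matrix.isUnit_nonsing_inv_iff).2 ha
  have cu : ∀ k ∈ H1, IsUnit (a * k * a⁻¹) := fun k hk => (ha.mul (hH1unit k hk)).mul hai
  have fwd : ∀ t ∈ S1, ∀ k ∈ H1, (s + dag a t - dag (a * k * a⁻¹) s) ∈ S2 ∧ a * k * a⁻¹ ∈ H2 := by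
    intro t ht k hk
    have : gmat s a * gmat t k * (gmat s a)⁻¹ ∈ sdp (S2 : Set M2) H2 := by
      rw [← hconj]; exact ⟨_, ⟨t, ht, k, hk, rfl⟩, rfl⟩
    rw [gmat_conj hs ha (hH1unit k hk)] at this
    obtain ⟨t', ht', k', hk', e⟩ := this
    obtain ⟨rfl, rfl⟩ := gmat_inj (cu k hk) e
    exact ⟨ht', hk'⟩
  have bwd : ∀ t ∈ S2, ∀ k ∈ H2, ∃ t' ∈ S1, ∃ k' ∈ H1,
      s + dag a t' - dag (a * k' * a⁻¹) s = t ∧ a * k' * a⁻¹ = k := by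
    intro t ht k hk
    have : gmat t k ∈ conj4 (gmat s a) (sdp (S1 : Set M2) H1) := by
      rw [hconj]; exact ⟨t, ht, k, hk, rfl⟩
    obtain ⟨x, ⟨t', ht', k', hk', rfl⟩, e⟩ := this
    simp only [gmat_conj hs ha (hH1unit k' hk')] at e
    obtain ⟨e1, e2⟩ := gmat_inj (cu k' hk') e
    exact ⟨t', ht', k', hk', e1, e2⟩
  have c1 : a * 1 * a⁻¹ = 1 := by rw [Matrix.mul_one, minv ha]
  have f1 : ∀ t ∈ S1, dag a t ∈ S2 := by
    intro t ht
    have := (fwd t ht 1 hH1one).1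
    rwa [c1, dag_one, add_sub_cancel_left] at this
  have b1 : ∀ t ∈ S2, ∃ t' ∈ S1, dag a t' = t := by
    intro t ht
    obtain ⟨t', ht', k', hk', e1, e2⟩ := bwd t ht 1 hH2one
    rw [e2, dag_one, add_sub_cancel_left] at e1
    exact ⟨t', ht', e1⟩
  have z : (0 : M2)ᵀ = 0 := transpose_zero
  have dz : ∀ k : M2, (0 : M2) - dag k 0 = 0 := by intro k; simp [dag_zero]
  ext x
  constructor
  · rintro ⟨_, ⟨t, ht, k, hk, rfl⟩, rfl⟩
    simp only [gmat_conj z ha (hH1unit k hk), dag_zero, zero_add, sub_zero]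
    exact ⟨_, f1 t ht, _, (fwd t ht k hk).2, rfl⟩
  · rintro ⟨t, ht, k, hk, rfl⟩
    obtain ⟨t', ht', e1⟩ := b1 t ht
    obtain ⟨_, -, k', hk', -, e2⟩ := bwd t ht k hk
    refine ⟨_, ⟨t', ht', k', hk', rfl⟩, ?_⟩
    simp only [gmat_conj z ha (hH1unit k' hk'), dag_zero, zero_add, sub_zero, e1, e2]

lemma rank_one {B : M2} (hB : B ≠ 0) (hd : B.det = 0) :
    ∃ u0 u1 v0 v1 : ℝ, B = !![u0 * v0, u0 * v1; u1 * v0, u1 * v1] ∧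
      u0 ^ 2 + u1 ^ 2 ≠ 0 ∧ v0 ^ 2 + v1 ^ 2 ≠ 0 := by
  rw [Matrix.det_fin_two] at hd
  have key : ∀ x y : ℝ, ¬ (x = 0 ∧ y = 0) → x ^ 2 + y ^ 2 ≠ 0 := by
    intro x y h h'
    exact h ⟨by nlinarith [sq_nonneg x, sq_nonneg y], by nlinarith [sq_nonneg x, sq_nonneg y]⟩
  by_cases h0 : B 0 0 = 0
  · by_cases h1 : B 0 1 = 0
    · refine ⟨0, 1, B 1 0, B 1 1, ?_, by norm_num, key _ _ ?_⟩
      · ext i j; fin_cases i <;> fin_cases j <;> simp [h0, h1]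
      · rintro ⟨h2, h3⟩
        apply hB
        ext i j; fin_cases i <;> fin_cases j <;> simp [h0, h1, h2, h3]
    · have h2 : B 1 0 = 0 := by
        rw [h0] at hd
        have : B 0 1 * B 1 0 = 0 := by linarith
        exact (mul_eq_zero.1 this).resolve_left h1
      refine ⟨1, B 1 1 / B 0 1, B 0 0, B 0 1, ?_, by positivity, key _ _ (fun h => h1 h.2)⟩
      ext i j; fin_cases i <;> fin_cases j <;> simp [h0, h1, h2]
  · refine ⟨1, B 1 0 / B 0 0, B 0 0, B 0 1, ?_, by positivity, key _ _ (fun h => h0 h.1)⟩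
    ext i j; fin_cases i <;> fin_cases j <;> simp [h0]
    field_simp
    linarith

def E1 : M2 := !![1, 0; 0, 0]

/-- Factorization in the rank one case. -/
lemma rank_one_factor {A B : M2} (hB : B ≠ 0) (hd : B.det = 0) (hAB : A * Bᵀ = B * Aᵀ) :
    ∃ (P Q : M2) (a : ℝ), IsUnit Q ∧ B = -(P * sigma4 * Qᵀ) ∧ A * Q = P * (E1 - a • sigma4) := by
  obtain ⟨u0, u1, v0, v1, hBe, hu, hv⟩ := rank_one hB hd
  have hvv : v0 * v0 + v1 * v1 ≠ 0 := by rwa [← sq, ← sq]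
  obtain ⟨x, hx⟩ : ∃ x : ℝ, x = A 0 0 * v0 + A 0 1 * v1 := ⟨_, rfl⟩
  obtain ⟨y, hy⟩ : ∃ y : ℝ, y = A 1 0 * v0 + A 1 1 * v1 := ⟨_, rfl⟩
  have hxy : x * u1 = y * u0 := by
    have := congrFun (congrFun hAB 0) 1
    rw [hBe] at this
    simp [Matrix.mul_apply, Fin.sum_univ_two] at this
    rw [hx, hy]; linarith
  refine ⟨!![A 0 0 * v1 - A 0 1 * v0, -u0; A 1 0 * v1 - A 1 1 * v0, -u1], !![v1, v0; -v0, v1],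
    (x * u0 + y * u1) / (u0 ^ 2 + u1 ^ 2), ?_, ?_, ?_⟩
  · rw [Matrix.isUnit_iff_isUnit_det, Matrix.det_fin_two, isUnit_iff_ne_zero]
    simp
    intro h; apply hvv; linarith
  · rw [hBe]
    ext i j; fin_cases i <;> fin_cases j <;>
      simp [Matrix.mul_apply, Fin.sum_univ_two, sigma4, Matrix.vecMul, dotProduct]
  · have f1 : (x * u0 + y * u1) / (u0 ^ 2 + u1 ^ 2) * u0 = x := by
      field_simp; linear_combination -u1 * hxy
    have f2 : (x * u0 + y * u1) / (u0 ^ 2 + u1 ^ 2) * u1 = y := by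
      field_simp; linear_combination u0 * hxy
    generalize (x * u0 + y * u1) / (u0 ^ 2 + u1 ^ 2) = c at f1 f2
    ext i j; fin_cases i <;> fin_cases j <;>
      simp [Matrix.mul_apply, Fin.sum_univ_two, sigma4, E1] <;> linarith

lemma conn_pos {H : Set M2} (hc : IsConnected H) (h1 : (1 : M2) ∈ H) (f : M2 → ℝ)
    (hf : Continuous f) (hf1 : f 1 = 1) (hne : ∀ k ∈ H, f k ≠ 0) : ∀ k ∈ H, 0 < f k := by
  intro k hk
  by_contra hneg
  push Not at hneg
  have := hc.isPreconnected.intermediate_value hk h1 hf.continuousOn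
  have h0 : (0 : ℝ) ∈ Set.Icc (f k) (f 1) := ⟨hneg, by rw [hf1]; norm_num⟩
  obtain ⟨z, hz, hz0⟩ := this h0
  exact hne z hz hz0

theorem stmt13 (S1 S2 : Submodule ℝ M2)
    (hS1sym : ∀ σ ∈ S1, σᵀ = σ) (hS2sym : ∀ σ ∈ S2, σᵀ = σ)
    (hS1ne : S1 ≠ ⊥) (hS2ne : S2 ≠ ⊥)
    (H1 H2 : Set M2)
    -- `H1`, `H2` are subgroups of `GL(2, ℝ)`
    (hH1unit : ∀ h ∈ H1, IsUnit h) (hH1one : (1 : M2) ∈ H1)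
    (hH1mul : ∀ h ∈ H1, ∀ k ∈ H1, h * k ∈ H1) (hH1inv : ∀ h ∈ H1, h⁻¹ ∈ H1)
    (hH2unit : ∀ h ∈ H2, IsUnit h) (hH2one : (1 : M2) ∈ H2)
    (hH2mul : ∀ h ∈ H2, ∀ k ∈ H2, h * k ∈ H2) (hH2inv : ∀ h ∈ H2, h⁻¹ ∈ H2)
    -- nontrivial and connected
    (hH1nt : H1 ≠ {1}) (hH2nt : H2 ≠ {1})
    (hH1conn : IsConnected H1) (hH2conn : IsConnected H2)
    -- invariance of the vector parts
    (hact1 : ∀ h ∈ H1, dag h '' (S1 : Set M2) = S1)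
    (hact2 : ∀ h ∈ H2, dag h '' (S2 : Set M2) = S2)
    -- the groups are not conjugate by an element `g(0, h₀)` of `MA`
    (hnoMA : ¬ ∃ h₀ : M2, IsUnit h₀ ∧
      conj4 (gmat 0 h₀) (sdp (S1 : Set M2) H1) = sdp (S2 : Set M2) H2)
    (g : M4) (hg : g ∈ SpSet)
    (hconj : conj4 g (sdp (S1 : Set M2) H1) = sdp (S2 : Set M2) H2) :
    ∃ (σ' : M2) (h h' : M2) (a₀ : ℝ), σ'ᵀ = σ' ∧ IsUnit h ∧ IsUnit h' ∧
      g = (gmat σ' h')⁻¹ * w0 * gmat (a₀ • sigma4) h ∧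
      (∀ τ ∈ dag h '' (S1 : Set M2), (τ * sigma4).trace = 0) ∧
      ((fun k => h * k * h⁻¹) '' H1 ⊆ Tgrp) ∧
      (a₀ ≠ 0 → (fun k => h * k * h⁻¹) '' H1 ⊆
        {m : M2 | ∃ α β : ℝ, 0 < α ∧ m = !![α, 0; β, 1]}) := by
  obtain ⟨A, B, C, D, rfl⟩ : ∃ A B C D : M2, g = fromBlocks A B C D :=
    ⟨_, _, _, _, (fromBlocks_toBlocks g).symm⟩
  have hinv := sp_inv_blocks hg
  have e := Matrix.mul_nonsing_inv _ (sp_unit hg)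
  rw [hinv, fromBlocks_multiply, ← fromBlocks_one, fromBlocks_inj] at e
  obtain ⟨e1, e2, -, -⟩ := e
  have hAB : A * Bᵀ = B * Aᵀ := by
    rw [Matrix.mul_neg, neg_add_eq_zero] at e2; exact e2
  have key : ∀ s ∈ S1, ∀ k ∈ H1, (A * k + B * (s * k)) * Bᵀ = B * k⁻¹ᵀ * Aᵀ := by
    intro s hs k hk
    have : fromBlocks A B C D * gmat s k * (fromBlocks A B C D)⁻¹ ∈ sdp (S2 : Set M2) H2 := by
      rw [← hconj]; exact ⟨_, ⟨s, hs, k, hk, rfl⟩, rfl⟩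
    obtain ⟨t', -, k', -, e⟩ := this
    rw [hinv, gmat, gmat, fromBlocks_multiply, fromBlocks_multiply, fromBlocks_inj] at e
    have := e.2.1
    rw [Matrix.mul_neg, neg_add_eq_zero] at this
    rw [this]; simp
  have keyS : ∀ s ∈ S1, B * s * Bᵀ = 0 := by
    intro s hs
    have := key s hs 1 hH1one
    simp only [Matrix.mul_one, inv_one, transpose_one, Matrix.add_mul] at this
    rw [hAB] at this
    simpa using this
  have keyH : ∀ k ∈ H1, A * k * Bᵀ = B * k⁻¹ᵀ * Aᵀ := by
    intro k hk
    have := key 0 S1.zero_mem k hk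
    simpa using this
  have hB : B ≠ 0 := by
    rintro rfl
    obtain ⟨hA, s, hs, hge⟩ := sp_lower hg
    rw [hge] at hconj
    exact hnoMA ⟨A, hA, case_zero S1 S2 H1 H2 hH1unit hH1one hH2one s A hs hA hconj⟩
  have hd : B.det = 0 := by
    by_contra hne
    have hBu : IsUnit B := (Matrix.isUnit_iff_isUnit_det _).2 (isUnit_iff_ne_zero.2 hne)
    apply hS1ne
    rw [Submodule.eq_bot_iff]
    intro s hs
    calc s = (B⁻¹ * B) * s * (Bᵀ * B⁻¹ᵀ) := by rw [minv' hBu, tinv hBu]; simp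
      _ = B⁻¹ * (B * s * Bᵀ) * B⁻¹ᵀ := by simp only [Matrix.mul_assoc]
      _ = 0 := by rw [keyS s hs]; simp
  obtain ⟨P, Q, a, hQ, hBe, hAe⟩ := rank_one_factor hB hd hAB
  have hQi : IsUnit Q⁻¹ := (Matrix.isUnit_nonsing_inv_iff).2 hQ
  have hQii : Q⁻¹⁻¹ = Q := Matrix.nonsing_inv_nonsing_inv _ ((Matrix.isUnit_iff_isUnit_det _).1 hQ)
  have hA : A = P * (E1 - a • sigma4) * Q⁻¹ := by
    rw [← hAe, Matrix.mul_assoc, minv hQ, Matrix.mul_one]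
  have s4t : sigma4ᵀ = sigma4 := by
    ext i j; fin_cases i <;> fin_cases j <;> simp [sigma4]
  have e1t : E1ᵀ = E1 := by
    ext i j; fin_cases i <;> fin_cases j <;> simp [E1]
  have hP : IsUnit P := by
    refine (Matrix.isUnit_iff_isUnit_det _).2 (Matrix.isUnit_det_of_right_inverse
      (B := (E1 - a • sigma4) * Q⁻¹ * Dᵀ + sigma4 * Qᵀ * Cᵀ) ?_)
    rw [← e1]
    nth_rewrite 1 [hA]
    rw [hBe, Matrix.mul_add]
    simp only [Matrix.mul_assoc, Matrix.neg_mul, Matrix.mul_neg, neg_neg]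
  have hBt : Bᵀ = -(Q * sigma4 * Pᵀ) := by
    rw [hBe]; simp only [transpose_neg, transpose_mul, transpose_transpose, s4t, Matrix.mul_assoc]
  have hAQt : Qᵀ * Aᵀ = (E1 - a • sigma4) * Pᵀ := by
    rw [← transpose_mul, hAe, transpose_mul, transpose_sub, transpose_smul, s4t, e1t]
  have m1 : (E1 - a • sigma4) * sigma4 = sigma4 * (E1 - a • sigma4) := by
    ext i j; fin_cases i <;> fin_cases j <;> simp [sigma4, E1, Matrix.mul_apply, Matrix.vecMul, dotProduct, Fin.sum_univ_two]
  have hW : w0 * gmat (a • sigma4) Q⁻¹ ∈ SpSet :=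
    sp_mul w0_sp (gmat_sp (by rw [transpose_smul, s4t]) hQi)
  have hWe : w0 * gmat (a • sigma4) Q⁻¹ =
      fromBlocks ((E1 - a • sigma4) * Q⁻¹) (-(sigma4 * Qᵀ)) (sigma4 * Q⁻¹) (E1 * Qᵀ) := by
    rw [w0, gmat, fromBlocks_multiply, hQii]
    change fromBlocks (E1 * _ + -sigma4 * _) (E1 * _ + -sigma4 * _) (sigma4 * _ + E1 * _)
      (sigma4 * _ + E1 * _) = _
    have z1 : sigma4 * sigma4 = sigma4 := by
      ext i j; fin_cases i <;> fin_cases j <;> simp [sigma4, Matrix.mul_apply]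
    have z2 : E1 * sigma4 = 0 := by
      ext i j; fin_cases i <;> fin_cases j <;> simp [sigma4, E1, Matrix.mul_apply, Matrix.vecMul, dotProduct]
    congr 1
    · rw [Matrix.neg_mul, ← Matrix.mul_assoc, Matrix.mul_smul, z1, Matrix.sub_mul, sub_eq_add_neg]
    · simp
    · rw [← Matrix.mul_assoc, Matrix.mul_smul, z2]; simp
    · simp
  have hN : w0 * gmat (a • sigma4) Q⁻¹ * (fromBlocks A B C D)⁻¹ ∈ SpSet :=
    sp_mul hW (sp_inv_mem hg)
  have hNe : ∃ X Y Z : M2, w0 * gmat (a • sigma4) Q⁻¹ * (fromBlocks A B C D)⁻¹ =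
      fromBlocks X 0 Y Z := by
    rw [hWe, hinv, fromBlocks_multiply]
    suffices hz : (E1 - a • sigma4) * Q⁻¹ * -Bᵀ + -(sigma4 * Qᵀ) * Aᵀ = 0 by
      rw [hz]; exact ⟨_, _, _, rfl⟩
    rw [hBt, neg_neg, Matrix.neg_mul, Matrix.mul_assoc sigma4, hAQt, ← Matrix.mul_assoc sigma4,
      ← m1, ← sub_eq_add_neg, sub_eq_zero]
    calc (E1 - a • sigma4) * Q⁻¹ * (Q * sigma4 * Pᵀ)
        = (E1 - a • sigma4) * (Q⁻¹ * Q) * (sigma4 * Pᵀ) := by simp only [Matrix.mul_assoc]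
      _ = _ := by rw [minv' hQ]; simp only [Matrix.mul_assoc, Matrix.mul_one]
  obtain ⟨X, Y, Z, hXYZ⟩ := hNe
  rw [hXYZ] at hN
  obtain ⟨hX, s, hs, hNs⟩ := sp_lower hN
  have hk' : ∀ k ∈ H1, (Q⁻¹ * k * Q) 0 1 = 0 ∧
      (a ≠ 0 → (Q⁻¹ * k * Q) 1 1 * (Q⁻¹ * k * Q) 1 1 = 1) := by
    intro k hk
    have hku := hH1unit k hk
    obtain ⟨m, hm⟩ : ∃ m, m = Q⁻¹ * k * Q := ⟨_, rfl⟩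
    have hmi : m⁻¹ = Q⁻¹ * k⁻¹ * Q := by
      rw [hm, Matrix.mul_inv_rev, Matrix.mul_inv_rev, hQii, Matrix.mul_assoc]
    have hmu : IsUnit m := by rw [hm]; exact (hQi.mul hku).mul hQ
    have h1 : A * k * Bᵀ = -(P * ((E1 - a • sigma4) * m * sigma4) * Pᵀ) := by
      rw [hA, hBt, hm]; simp only [Matrix.mul_assoc, Matrix.mul_neg]
    have h2 : B * k⁻¹ᵀ * Aᵀ = -(P * (sigma4 * m⁻¹ᵀ * (E1 - a • sigma4)) * Pᵀ) := by
      have : Aᵀ = Q⁻¹ᵀ * ((E1 - a • sigma4) * Pᵀ) := by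
        rw [← hAQt, ← Matrix.mul_assoc, tinv' hQ, Matrix.one_mul]
      rw [this, hBe, hmi]
      simp only [Matrix.mul_assoc, Matrix.neg_mul, transpose_mul]
    have h3 := keyH k hk
    rw [h1, h2, neg_inj] at h3
    have hPt : IsUnit Pᵀ := (Matrix.isUnit_transpose _).2 hP
    have h4 := hP.mul_left_cancel (hPt.mul_right_cancel h3)
    rw [← hm]
    have h01 : m 0 1 = 0 := by
      have := congrFun (congrFun h4 0) 1
      simpa [sigma4, E1, Matrix.mul_apply, Matrix.vecMul, dotProduct, Fin.sum_univ_two] using this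
    refine ⟨h01, fun ha => ?_⟩
    have h5 : m 1 1 = m⁻¹ 1 1 := by
      have := congrFun (congrFun h4 1) 1
      simp [sigma4, E1, Matrix.mul_apply, Matrix.vecMul, dotProduct, Fin.sum_univ_two] at this
      have h6 : a * m 1 1 = a * m⁻¹ 1 1 := by linarith
      exact mul_left_cancel₀ ha h6
    have h7 := congrFun (congrFun (minv' hmu) 1) 1
    simp [Matrix.mul_apply, Fin.sum_univ_two, h01] at h7
    rwa [← h5] at h7
  have hdet : ∀ k ∈ H1, (Q⁻¹ * k * Q) 0 0 * (Q⁻¹ * k * Q) 1 1 ≠ 0 := by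
    intro k hk
    have hmu : IsUnit (Q⁻¹ * k * Q) := (hQi.mul (hH1unit k hk)).mul hQ
    have := isUnit_iff_ne_zero.1 ((Matrix.isUnit_iff_isUnit_det _).1 hmu)
    rw [Matrix.det_fin_two, (hk' k hk).1] at this
    simpa using this
  have hpos : ∀ i : Fin 2, (∀ k ∈ H1, (Q⁻¹ * k * Q) i i ≠ 0) → ∀ k ∈ H1, 0 < (Q⁻¹ * k * Q) i i := by
    intro i hi
    refine conn_pos hH1conn hH1one (fun k => (Q⁻¹ * k * Q) i i) ?_ ?_ hi
    · have : Continuous (fun k : M2 => Q⁻¹ * k * Q) := by fun_prop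
      exact this.matrix_elem i i
    · simp [minv' hQ]
  refine ⟨s, Q⁻¹, X, a, hs, hQi, hX, ?_, ?_, ?_, ?_⟩
  · have hu := sp_unit (gmat_sp hs hX)
    have h1 : gmat s X * fromBlocks A B C D = w0 * gmat (a • sigma4) Q⁻¹ := by
      rw [← hNs, ← hXYZ, Matrix.mul_assoc, Matrix.nonsing_inv_mul _ (sp_unit hg), Matrix.mul_one]
    rw [Matrix.mul_assoc, ← h1, ← Matrix.mul_assoc, Matrix.nonsing_inv_mul _ hu, Matrix.one_mul]
  · rintro _ ⟨t, ht, rfl⟩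
    have h1 := keyS t ht
    rw [hBt, hBe] at h1
    have h2 : P * (sigma4 * (Qᵀ * t * Q) * sigma4) * Pᵀ = P * 0 * Pᵀ := by
      rw [Matrix.mul_zero, Matrix.zero_mul, ← h1]
      simp only [Matrix.mul_assoc, Matrix.neg_mul, Matrix.mul_neg, neg_neg]
    have hPt : IsUnit Pᵀ := (Matrix.isUnit_transpose _).2 hP
    have h3 := hP.mul_left_cancel (hPt.mul_right_cancel h2)
    rw [dag, hQii]
    generalize Qᵀ * t * Q = r at h3
    have := congrFun (congrFun h3 1) 1
    simp [sigma4, Matrix.mul_apply, Matrix.vecMul, dotProduct, Fin.sum_univ_two] at this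
    simp [Matrix.trace, sigma4, Matrix.mul_apply, Fin.sum_univ_two, this]
  · rintro _ ⟨k, hk, rfl⟩
    simp only [hQii]
    refine ⟨(Q⁻¹ * k * Q) 1 1, (Q⁻¹ * k * Q) 1 0, (Q⁻¹ * k * Q) 0 0, ?_, ?_⟩
    · rw [mul_comm]; exact hdet k hk
    · rw [← (hk' k hk).1]; exact Matrix.eta_fin_two _
  · rintro ha _ ⟨k, hk, rfl⟩
    simp only [hQii]
    have p0 := hpos 0 (fun k hk => left_ne_zero_of_mul (hdet k hk)) k hk
    have p1 := hpos 1 (fun k hk => right_ne_zero_of_mul (hdet k hk)) k hk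
    have h11 : (Q⁻¹ * k * Q) 1 1 = 1 := by
      have := (hk' k hk).2 ha
      nlinarith
    refine ⟨(Q⁻¹ * k * Q) 0 0, (Q⁻¹ * k * Q) 1 0, p0, ?_⟩
    rw [← (hk' k hk).1, ← h11]; exact Matrix.eta_fin_two _
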